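/- Let α < 0, c > 0, and let M ⊂ {z ≥ c} be a compact α-singular minimal graph over the plane z = c with boundary in that plane, of maximal height h = max_M z. Then the area of M satisfies A(M) ≥ -(2π/α)(h² - c²). -/

import Mathlib

open MeasureTheory

open Set Real Filter Topology in
theorem integral_eq_of_polar_eq {f F : ℝ × ℝ → ℝ} (hF : Continuous F) {R : ℝ}
    (hR : ∀ r θ, R ≤ r → F (r, θ) = 0)
    (hf : ∀ r θ, 0 < r → r * f (r * cos θ, r * sin θ) = F (r, θ)) :
    ∫ z, f z = ∫ θ in Ioo (-π) π, ∫ r in Ioi 0, F (r, θ) := by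
  have hFi : IntegrableOn F (Ioi 0 ×ˢ Ioo (-π) π) := by
    have h1 : IntegrableOn F (Icc 0 R ×ˢ Icc (-π) π) :=
      hF.continuousOn.integrableOn_compact (isCompact_Icc.prod isCompact_Icc)
    refine IntegrableOn.of_forall_sdiff_eq_zero h1
      (measurableSet_Ioi.prod measurableSet_Ioo) ?_
    rintro ⟨r, θ⟩ ⟨⟨h0, hθ⟩, h2⟩
    refine hR r θ (le_of_not_ge fun h ↦ h2 ⟨⟨le_of_lt h0, h⟩, ⟨hθ.1.le, hθ.2.le⟩⟩)
  rw [← integral_comp_polarCoord_symm]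
  have h2 : ∫ p in polarCoord.target, p.1 • f (polarCoord.symm p)
      = ∫ p in Ioi (0 : ℝ) ×ˢ Ioo (-π) π, F p := by
    refine setIntegral_congr_fun polarCoord.open_target.measurableSet ?_
    rintro ⟨r, θ⟩ ⟨h0, -⟩
    simpa using hf r θ h0
  rw [h2]
  have h3 := setIntegral_prod_swap (μ := (volume : Measure ℝ)) (ν := (volume : Measure ℝ))
    (Ioi 0) (Ioo (-π) π) F
  rw [Measure.volume_eq_prod, ← h3, setIntegral_prod]
  · rfl
  · exact hFi.swap

/-- The logarithmic potential inverts the Laplacian in the plane, in first order form. -/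
theorem integral_radial_fderiv_div_sq {η : ℝ × ℝ → ℝ} (hη : ContDiff ℝ 1 η)
    (hc : HasCompactSupport η) (y : ℝ × ℝ) :
    ∫ z : ℝ × ℝ, (z.1 * fderiv ℝ η (y + z) (1, 0) + z.2 * fderiv ℝ η (y + z) (0, 1)) /
      (z.1 ^ 2 + z.2 ^ 2) = -(2 * Real.pi) * η y := by
  obtain ⟨R, hR⟩ : ∃ R : ℝ, ∀ x, R ≤ ‖x‖ → η x = 0 ∧ fderiv ℝ η x = 0 := by
    obtain ⟨R, hR⟩ := hc.isCompact.isBounded.subset_ball 0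
    refine ⟨R, fun x hx ↦ ?_⟩
    have : x ∉ tsupport η := fun h ↦ by
      have := hR h
      simp at this
      linarith
    exact ⟨image_eq_zero_of_notMem_tsupport this, by
      have h1 := support_fderiv_subset ℝ (f := η)
      by_contra h
      exact this (h1 h)⟩
  have hd : Continuous fun x ↦ fderiv ℝ η x := hη.continuous_fderiv one_ne_zero
  have hbig : ∀ r θ : ℝ, 2 * (|R| + ‖y‖) + 1 ≤ r →
      R ≤ ‖y + (r * Real.cos θ, r * Real.sin θ)‖ := by
    intro r θ hr
    have h1 : r ≤ 2 * ‖((r * Real.cos θ, r * Real.sin θ) : ℝ × ℝ)‖ := by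
      have ha := norm_fst_le ((r * Real.cos θ, r * Real.sin θ) : ℝ × ℝ)
      have hb := norm_snd_le ((r * Real.cos θ, r * Real.sin θ) : ℝ × ℝ)
      simp only [Real.norm_eq_abs] at ha hb
      set N := ‖((r * Real.cos θ, r * Real.sin θ) : ℝ × ℝ)‖
      have hr0 : 0 ≤ r := by
        have := abs_nonneg R
        have := norm_nonneg y
        linarith
      have := sq_abs (r * Real.cos θ)
      have := sq_abs (r * Real.sin θ)
      have := Real.sin_sq_add_cos_sq θ
      have hN : 0 ≤ N := norm_nonneg _
      have : r ^ 2 ≤ 2 * N ^ 2 := by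
        have e1 : |r * Real.cos θ| ^ 2 ≤ N ^ 2 := by gcongr
        have e2 : |r * Real.sin θ| ^ 2 ≤ N ^ 2 := by gcongr
        rw [sq_abs] at e1 e2
        nlinarith
      nlinarith
    have h2 := norm_sub_norm_le ((r * Real.cos θ, r * Real.sin θ) : ℝ × ℝ) (-y)
    rw [norm_neg, sub_neg_eq_add, add_comm _ y] at h2
    have := le_abs_self R
    have := abs_nonneg R
    linarith
  set D : ℝ × ℝ → ℝ := fun p ↦ fderiv ℝ η (y + (p.1 * Real.cos p.2, p.1 * Real.sin p.2))
    (Real.cos p.2, Real.sin p.2) with hD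
  have hDc : Continuous D := by
    rw [hD]
    fun_prop
  rw [integral_eq_of_polar_eq (F := D) (R := 2 * (|R| + ‖y‖) + 1) hDc]
  · have hin : ∀ θ : ℝ, ∫ r in Set.Ioi 0, D (r, θ) = - η y := by
      intro θ
      have hder : ∀ r : ℝ, HasDerivAt (fun r : ℝ ↦ η (y + (r * Real.cos θ, r * Real.sin θ)))
          (D (r, θ)) r := by
        intro r
        have h1 : HasDerivAt (fun r : ℝ ↦ y + (r * Real.cos θ, r * Real.sin θ))
            (Real.cos θ, Real.sin θ) r := by
          have := (((hasDerivAt_id r).mul_const (Real.cos θ)).prodMk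
            ((hasDerivAt_id r).mul_const (Real.sin θ))).const_add y
          simpa using this
        exact (hη.differentiable one_ne_zero _).hasFDerivAt.comp_hasDerivAt r h1
      have hDr : Continuous fun r : ℝ ↦ D (r, θ) := by fun_prop
      have := integral_Ioi_of_hasDerivAt_of_tendsto (a := 0) (m := (0 : ℝ))
        (hder 0).continuousAt.continuousWithinAt (fun r _ ↦ hder r) ?_ ?_
      · rw [this]
        have h0 : y + ((0 : ℝ) * Real.cos θ, (0 : ℝ) * Real.sin θ) = y := by
          ext <;> simp
        rw [h0, zero_sub]
      · refine IntegrableOn.of_forall_sdiff_eq_zero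
          (hDr.continuousOn.integrableOn_Icc (a := 0) (b := 2 * (|R| + ‖y‖) + 1))
          measurableSet_Ioi ?_
        rintro r ⟨h0, h1⟩
        have := (hR _ (hbig r θ (le_of_not_ge fun h ↦ h1 ⟨le_of_lt h0, h⟩))).2
        simp [hD, this]
      · refine tendsto_const_nhds.congr' ?_
        filter_upwards [Filter.eventually_ge_atTop (2 * (|R| + ‖y‖) + 1)] with r hr
        exact (hR _ (hbig r θ hr)).1.symm
    simp only [hin]
    rw [setIntegral_const, Real.volume_real_Ioo_of_le (by linarith [Real.pi_pos]), smul_eq_mul]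
    ring
  · intro r θ hr
    simp [hD, (hR _ (hbig r θ hr)).2]
  · intro r θ hr
    have h1 : ((Real.cos θ, Real.sin θ) : ℝ × ℝ) =
      Real.cos θ • ((1, 0) : ℝ × ℝ) + Real.sin θ • ((0, 1) : ℝ × ℝ) := by simp
    simp only [hD]
    rw [h1, map_add, map_smul, map_smul]
    have h2 : (r * Real.cos θ) ^ 2 + (r * Real.sin θ) ^ 2 = r ^ 2 := by
      have := Real.sin_sq_add_cos_sq θ
      linear_combination r ^ 2 * this
    simp only [h2, smul_eq_mul]
    field_simp

theorem integrable_indicator_ball_inv_norm (R : ℝ) :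
    Integrable (fun z : ℝ × ℝ ↦ (Set.Iio R).indicator (fun r ↦ r⁻¹) ‖z‖) := by
  rw [integrable_fun_norm_addHaar (volume : Measure (ℝ × ℝ))
    (f := fun x ↦ (Set.Iio R).indicator (fun r ↦ r⁻¹) x)]
  have h1 : IntegrableOn (fun _ : ℝ ↦ (1 : ℝ)) (Set.Icc 0 R) := by simp
  have h2 : IntegrableOn ((Set.Iio R).indicator fun _ : ℝ ↦ (1 : ℝ)) (Set.Ioi 0) := by
    refine IntegrableOn.of_forall_sdiff_eq_zero (h1.indicator measurableSet_Iio)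
      measurableSet_Ioi ?_
    rintro r ⟨h0, h2⟩
    have h3 : r ∉ Set.Iio R := fun h ↦ h2 ⟨le_of_lt h0, le_of_lt h⟩
    simp [h3]
  refine h2.congr_fun ?_ measurableSet_Ioi
  intro r hr
  have : r ≠ 0 := ne_of_gt hr
  by_cases h : r < R <;> simp [Set.indicator, h, this]

theorem abs_kernel_le (a b : ℝ) (z : ℝ × ℝ) :
    |(a * z.1 + b * z.2) / (z.1 ^ 2 + z.2 ^ 2)| ≤ (|a| + |b|) * ‖z‖⁻¹ := by
  rcases eq_or_ne z 0 with rfl | hz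
  · simp
  have hN : 0 < ‖z‖ := norm_pos_iff.2 hz
  have h1 : ‖z‖ ^ 2 ≤ z.1 ^ 2 + z.2 ^ 2 := by
    rcases max_choice ‖z.1‖ ‖z.2‖ with h | h
    · rw [Prod.norm_def, h, Real.norm_eq_abs, sq_abs]; nlinarith [sq_nonneg z.2]
    · rw [Prod.norm_def, h, Real.norm_eq_abs, sq_abs]; nlinarith [sq_nonneg z.1]
  have h3 : 0 < z.1 ^ 2 + z.2 ^ 2 := lt_of_lt_of_le (by positivity) h1
  have h2 : |a * z.1 + b * z.2| ≤ (|a| + |b|) * ‖z‖ := by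
    have ha := norm_fst_le z
    have hb := norm_snd_le z
    rw [Real.norm_eq_abs] at ha hb
    calc _ ≤ |a * z.1| + |b * z.2| := abs_add_le _ _
      _ = |a| * |z.1| + |b| * |z.2| := by rw [abs_mul, abs_mul]
      _ ≤ |a| * ‖z‖ + |b| * ‖z‖ := by gcongr
      _ = _ := by ring
  rw [abs_div, abs_of_pos h3]
  calc _ ≤ (|a| + |b|) * ‖z‖ / ‖z‖ ^ 2 := by gcongr
    _ = _ := by field_simp

theorem hasDerivAt_max_zero_sq (x : ℝ) :
    HasDerivAt (fun x : ℝ ↦ (max x 0) ^ 2) (2 * max x 0) x := by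
  rcases lt_trichotomy x 0 with h | rfl | h
  · rw [max_eq_right h.le, mul_zero]
    refine (hasDerivAt_const x (0 : ℝ)).congr_of_eventuallyEq ?_
    filter_upwards [eventually_lt_nhds h] with y hy
    simp [max_eq_right hy.le]
  · have : HasDerivAt (fun x : ℝ ↦ x * max x 0) (1 * max 0 0) 0 := by
      rw [hasDerivAt_iff_isLittleO]
      simp only [sub_zero, max_self, mul_zero, smul_eq_mul]
      have h1 : (fun x : ℝ ↦ max x 0) =o[nhds 0] fun _ ↦ (1 : ℝ) := by
        rw [Asymptotics.isLittleO_one_iff]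
        have : Continuous fun x : ℝ ↦ max x 0 := by fun_prop
        simpa using this.tendsto 0
      simpa using (Asymptotics.isBigO_refl (fun x : ℝ ↦ x) (nhds 0)).mul_isLittleO h1
    convert this using 1
    · ext y
      rcases le_total y 0 with h | h
      · simp [max_eq_right h]
      · simp [max_eq_left h]; ring
    · simp
  · rw [max_eq_left h.le]
    have : HasDerivAt (fun x : ℝ ↦ x ^ 2) (2 * x) x := by simpa using hasDerivAt_pow 2 x
    refine this.congr_of_eventuallyEq ?_
    filter_upwards [eventually_gt_nhds h] with y hy
    simp [max_eq_left hy.le]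

theorem integral_Ioi_max_sub_mul (g : ℝ) {s : ℝ} (hs : 0 < s) :
    ∫ r in Set.Ioi 0, max (g - s * r) 0 = (max g 0) ^ 2 / (2 * s) := by
  have h1 : ∀ r : ℝ, HasDerivAt (fun r ↦ -((max (g - s * r) 0) ^ 2 / (2 * s)))
      (max (g - s * r) 0) r := by
    intro r
    have h2 : HasDerivAt (fun r ↦ g - s * r) (-s) r := by
      simpa using ((hasDerivAt_id r).const_mul s).const_sub g
    refine HasDerivAt.congr_deriv
      (((hasDerivAt_max_zero_sq (g - s * r)).comp r h2).div_const (2 * s)).neg ?_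
    field_simp
  rw [integral_Ioi_of_hasDerivAt_of_nonneg' (l := 0) (fun r _ ↦ h1 r)
    (fun r _ ↦ le_max_right _ _)]
  · simp
  · refine tendsto_const_nhds.congr' ?_
    filter_upwards [Filter.eventually_ge_atTop (g / s)] with r hr
    have : g - s * r ≤ 0 := by
      rw [div_le_iff₀ hs] at hr; linarith
    simp [max_eq_right this]

theorem integral_max_trig_sq (a b : ℝ) :
    ∫ θ in Set.Ioo (-Real.pi) Real.pi, (max (a * Real.cos θ + b * Real.sin θ) 0) ^ 2
      = Real.pi * (a ^ 2 + b ^ 2) / 2 := by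
  rw [← integral_Ioc_eq_integral_Ioo,
    ← intervalIntegral.integral_of_le (by linarith [Real.pi_pos])]
  have hi : ∀ x y : ℝ, IntervalIntegrable
      (fun θ ↦ (max (a * Real.cos θ + b * Real.sin θ) 0) ^ 2) volume x y :=
    fun x y ↦ Continuous.intervalIntegrable (by fun_prop) _ _
  have hi' : ∀ x y : ℝ, IntervalIntegrable
      (fun θ ↦ (max (-(a * Real.cos θ + b * Real.sin θ)) 0) ^ 2) volume x y :=
    fun x y ↦ Continuous.intervalIntegrable (by fun_prop) _ _
  rw [← intervalIntegral.integral_add_adjacent_intervals (hi _ 0) (hi 0 _)]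
  have hshift : ∫ θ in (-Real.pi)..0, (max (a * Real.cos θ + b * Real.sin θ) 0) ^ 2
      = ∫ θ in (0 : ℝ)..Real.pi, (max (-(a * Real.cos θ + b * Real.sin θ)) 0) ^ 2 := by
    have := intervalIntegral.integral_comp_sub_right (a := 0) (b := Real.pi)
      (fun θ ↦ (max (a * Real.cos θ + b * Real.sin θ) 0) ^ 2) Real.pi
    simp only [zero_sub, sub_self] at this
    rw [← this]
    congr 1
    ext θ
    rw [Real.cos_sub_pi, Real.sin_sub_pi]
    congr 2
    ring
  rw [hshift, ← intervalIntegral.integral_add (hi' _ _) (hi _ _)]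
  have : ∀ θ : ℝ, (max (-(a * Real.cos θ + b * Real.sin θ)) 0) ^ 2
      + (max (a * Real.cos θ + b * Real.sin θ) 0) ^ 2
      = a ^ 2 * Real.cos θ ^ 2 + (2 * a * b) * (Real.sin θ * Real.cos θ)
        + b ^ 2 * Real.sin θ ^ 2 := by
    intro θ
    rcases le_total (a * Real.cos θ + b * Real.sin θ) 0 with h | h
    · rw [max_eq_right h, max_eq_left (by linarith)]; ring
    · rw [max_eq_left h, max_eq_right (by linarith)]; ring
  simp only [this]
  rw [intervalIntegral.integral_add, intervalIntegral.integral_add,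
    intervalIntegral.integral_const_mul, intervalIntegral.integral_const_mul,
    intervalIntegral.integral_const_mul, integral_cos_sq, integral_sin_sq,
    integral_sin_mul_cos₁]
  · simp; ring
  all_goals exact Continuous.intervalIntegrable (by fun_prop) _ _

/-- The Ahlfors-Beurling bound for the Cauchy kernel. -/
theorem setIntegral_kernel_le (a b : ℝ) {E : Set (ℝ × ℝ)}
    (hb : Bornology.IsBounded E) :
    ∫ z in E, (a * z.1 + b * z.2) / (z.1 ^ 2 + z.2 ^ 2)
      ≤ Real.sqrt (a ^ 2 + b ^ 2) * Real.sqrt (Real.pi * volume.real E) := by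
  set f : ℝ × ℝ → ℝ := fun z ↦ (a * z.1 + b * z.2) / (z.1 ^ 2 + z.2 ^ 2) with hf
  have hfm : Measurable f := by rw [hf]; fun_prop
  have hfE : ∀ F : Set (ℝ × ℝ), Bornology.IsBounded F → IntegrableOn f F := by
    intro F hF
    obtain ⟨R, hR⟩ := hF.subset_ball 0
    refine IntegrableOn.mono_set ?_ hR
    refine Integrable.mono' ((integrable_indicator_ball_inv_norm R).const_mul
      (|a| + |b|)).integrableOn hfm.aestronglyMeasurable ?_
    refine (ae_restrict_iff' measurableSet_ball).2 (.of_forall fun z hz ↦ ?_)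
    have : ‖z‖ ∈ Set.Iio R := by simpa using hz
    rw [Set.indicator_of_mem this]
    exact abs_kernel_le a b z
  have key : ∀ s : ℝ, 0 < s → ∫ z in E, f z ≤
      s * volume.real E + Real.pi * (a ^ 2 + b ^ 2) / (4 * s) := by
    intro s hs
    have hzero : ∀ z ∉ Metric.closedBall (0 : ℝ × ℝ) ((|a| + |b|) / s), max (f z - s) 0 = 0 := by
      intro z hz
      have hz' : (|a| + |b|) / s < ‖z‖ := by simpa using hz
      have hN : 0 < ‖z‖ := lt_of_le_of_lt (by positivity) hz'
      refine max_eq_right ?_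
      have := (le_abs_self _).trans (abs_kernel_le a b z)
      have h2 : (|a| + |b|) * ‖z‖⁻¹ ≤ s := by
        rw [div_lt_iff₀ hs] at hz'
        rw [← div_eq_mul_inv, div_le_iff₀ hN]; linarith
      simp only [hf]
      linarith
    have hpi : Integrable fun z ↦ max (f z - s) 0 := by
      rw [← integrableOn_iff_integrable_of_support_subset (s := Metric.closedBall 0
        ((|a| + |b|) / s)) (Function.support_subset_iff'.2 hzero)]
      refine Integrable.pos_part (Integrable.sub (hfE _ Metric.isBounded_closedBall) ?_)
      exact integrableOn_const (Metric.isBounded_closedBall.measure_lt_top).ne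
    have hpol : ∫ z, max (f z - s) 0 = Real.pi * (a ^ 2 + b ^ 2) / (4 * s) := by
      rw [integral_eq_of_polar_eq
        (F := fun p ↦ max (a * Real.cos p.2 + b * Real.sin p.2 - s * p.1) 0)
        (R := (|a| + |b|) / s) (by fun_prop)]
      · simp only [integral_Ioi_max_sub_mul _ hs]
        rw [integral_div, integral_max_trig_sq]
        field_simp
        norm_num
      · intro r θ hr
        refine max_eq_right ?_
        rw [div_le_iff₀ hs] at hr
        have h1 : a * Real.cos θ ≤ |a| := by
          refine (le_abs_self _).trans ?_
          rw [abs_mul]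
          exact mul_le_of_le_one_right (abs_nonneg _) (Real.abs_cos_le_one θ)
        have h2 : b * Real.sin θ ≤ |b| := by
          refine (le_abs_self _).trans ?_
          rw [abs_mul]
          exact mul_le_of_le_one_right (abs_nonneg _) (Real.abs_sin_le_one θ)
        simp only
        linarith
      · intro r θ hr
        have h2 : (r * Real.cos θ) ^ 2 + (r * Real.sin θ) ^ 2 = r ^ 2 := by
          have := Real.sin_sq_add_cos_sq θ
          linear_combination r ^ 2 * this
        simp only [hf, h2]
        rw [mul_max_of_nonneg _ _ hr.le, mul_zero]
        congr 1
        field_simp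
    have hfin : volume E ≠ ⊤ := hb.measure_lt_top.ne
    have h1 : ∫ z in E, f z ≤ ∫ z in E, (s + max (f z - s) 0) := by
      refine integral_mono (hfE E hb) ((integrableOn_const hfin).add hpi.integrableOn) ?_
      intro z
      have := le_max_left (f z - s) 0
      simp only
      linarith
    rw [integral_add (integrableOn_const (C := s) hfin) hpi.integrableOn] at h1
    have h2 : ∫ z in E, max (f z - s) 0 ≤ ∫ z, max (f z - s) 0 :=
      setIntegral_le_integral hpi (.of_forall fun z ↦ le_max_right _ _)
    rw [hpol] at h2
    simp only [setIntegral_const, smul_eq_mul] at h1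
    linarith
  rcases eq_or_lt_of_le (measureReal_nonneg (μ := volume) (s := E)) with hm | hm
  · have : volume E = 0 := by
      rcases (measureReal_eq_zero_iff hb.measure_lt_top.ne).1 hm.symm with h
      exact h
    rw [Measure.restrict_eq_zero.2 this, ← hm]
    simp
  · set m := volume.real E
    rcases eq_or_lt_of_le (by positivity : 0 ≤ a ^ 2 + b ^ 2) with h0 | h0
    · have ha : a = 0 := by nlinarith [sq_nonneg a, sq_nonneg b]
      have hb : b = 0 := by nlinarith [sq_nonneg a, sq_nonneg b]
      simp [hf, ha, hb]
    · set ρ := Real.sqrt (a ^ 2 + b ^ 2) with hρ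
      set q := Real.sqrt (Real.pi * m) with hq
      have hρ0 : 0 < ρ := Real.sqrt_pos.2 h0
      have hq0 : 0 < q := Real.sqrt_pos.2 (by positivity)
      have h1 : ρ ^ 2 = a ^ 2 + b ^ 2 := Real.sq_sqrt h0.le
      have h2 : q ^ 2 = Real.pi * m := Real.sq_sqrt (by positivity)
      have h3 := key (ρ * q / (2 * m)) (by positivity)
      refine h3.trans (le_of_eq ?_)
      rw [← h1]
      have : Real.pi = q ^ 2 / m := by field_simp; linarith
      rw [this]
      field_simp
      ring

theorem setIntegral_kernel_sub_ge (a b : ℝ) {E : Set (ℝ × ℝ)} (hb : Bornology.IsBounded E)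
    (x : ℝ × ℝ) :
    -(Real.sqrt (a ^ 2 + b ^ 2) * Real.sqrt (Real.pi * volume.real E)) ≤
    ∫ y in E, (a * (x - y).1 + b * (x - y).2) / ((x - y).1 ^ 2 + (x - y).2 ^ 2) := by
  have h1 := (measurePreserving_add_right (volume : Measure (ℝ × ℝ)) x).setIntegral_preimage_emb
    (MeasurableEquiv.addRight x).measurableEmbedding
    (fun y ↦ (a * (x - y).1 + b * (x - y).2) / ((x - y).1 ^ 2 + (x - y).2 ^ 2)) E
  rw [← h1]
  have h2 : volume.real ((· + x) ⁻¹' E) = volume.real E := by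
    rw [Measure.real, measure_preimage_add_right, Measure.real]
  have h3 : Bornology.IsBounded ((· + x) ⁻¹' E) := by
    obtain ⟨C, hC⟩ := isBounded_iff_forall_norm_le.1 hb
    refine isBounded_iff_forall_norm_le.2 ⟨C + ‖x‖, fun z hz ↦ ?_⟩
    have := hC _ hz
    have h := norm_sub_le (z + x) x
    rw [add_sub_cancel_right] at h
    linarith
  have h4 := setIntegral_kernel_le a b h3
  rw [h2] at h4
  have h5 : ∀ z : ℝ × ℝ, (a * (x - (z + x)).1 + b * (x - (z + x)).2) /
      ((x - (z + x)).1 ^ 2 + (x - (z + x)).2 ^ 2)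
      = -((a * z.1 + b * z.2) / (z.1 ^ 2 + z.2 ^ 2)) := by
    intro z
    have : x - (z + x) = -z := by abel
    rw [this, ← neg_div]
    simp only [Prod.fst_neg, Prod.snd_neg, neg_sq]
    congr 1
    ring
  simp only [h5, integral_neg]
  linarith

/-- A functional form of the planar isoperimetric inequality. -/
theorem two_pi_mul_setIntegral_le {η : ℝ × ℝ → ℝ} (hη : ContDiff ℝ 1 η)
    (hc : HasCompactSupport η) {E : Set (ℝ × ℝ)} (hE : MeasurableSet E)
    (hb : Bornology.IsBounded E) :
    2 * Real.pi * ∫ y in E, η y ≤ Real.sqrt (Real.pi * volume.real E) *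
      ∫ x, Real.sqrt ((fderiv ℝ η x (1, 0)) ^ 2 + (fderiv ℝ η x (0, 1)) ^ 2) := by
  have hd : Continuous fun x ↦ fderiv ℝ η x := hη.continuous_fderiv one_ne_zero
  have hd1 : Continuous fun x ↦ fderiv ℝ η x (1, 0) := by fun_prop
  have hd2 : Continuous fun x ↦ fderiv ℝ η x (0, 1) := by fun_prop
  have hs : HasCompactSupport fun x ↦ fderiv ℝ η x := hc.fderiv ℝ
  obtain ⟨C, hC⟩ : ∃ C : ℝ, ∀ x, |fderiv ℝ η x (1, 0)| + |fderiv ℝ η x (0, 1)| ≤ C := by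
    have h1 : HasCompactSupport fun x ↦ |fderiv ℝ η x (1, 0)| + |fderiv ℝ η x (0, 1)| :=
      hs.comp_left (g := fun L : ℝ × ℝ →L[ℝ] ℝ ↦ |L (1, 0)| + |L (0, 1)|) (by simp)
    obtain ⟨C, hC⟩ := (hd1.abs.add hd2.abs).bounded_above_of_compact_support h1
    exact ⟨C, fun x ↦ (le_abs_self _).trans (hC x)⟩
  set F : ℝ × ℝ → ℝ × ℝ → ℝ := fun x y ↦
    (fderiv ℝ η x (1, 0) * (x - y).1 + fderiv ℝ η x (0, 1) * (x - y).2) /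
      ((x - y).1 ^ 2 + (x - y).2 ^ 2) with hF
  obtain ⟨R₁, hR₁⟩ := isBounded_iff_forall_norm_le.1 hb
  obtain ⟨R₂, hR₂⟩ := isBounded_iff_forall_norm_le.1 hc.isCompact.isBounded
  have hFi : Integrable (Function.uncurry F) (volume.prod (volume.restrict E)) := by
    have : IsFiniteMeasure (volume.restrict E) :=
      ⟨by simpa using hb.measure_lt_top⟩
    have h1 := Integrable.convolution_integrand (ContinuousLinearMap.mul ℝ ℝ)
      (integrable_const (μ := volume.restrict E) (1 : ℝ))
      (integrable_indicator_ball_inv_norm (R₁ + R₂ + 1))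
    refine Integrable.mono' (h1.const_mul C) ?_ ?_
    · refine Measurable.aestronglyMeasurable ?_
      have := hd1.measurable
      have := hd2.measurable
      simp only [hF, Function.uncurry_def]
      fun_prop
    · have h2 : ∀ᵐ p : (ℝ × ℝ) × (ℝ × ℝ) ∂(volume.prod (volume.restrict E)), p.2 ∈ E := by
        have := Measure.quasiMeasurePreserving_snd (μ := (volume : Measure (ℝ × ℝ)))
          (ν := volume.restrict E)
        exact this.ae (ae_restrict_mem hE)
      filter_upwards [h2] with p hp
      have hC0 := (add_nonneg (abs_nonneg _) (abs_nonneg _)).trans (hC 0)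
      have hnn : 0 ≤ (Set.Iio (R₁ + R₂ + 1)).indicator (fun r ↦ r⁻¹) ‖p.1 - p.2‖ := by
        by_cases h : ‖p.1 - p.2‖ ∈ Set.Iio (R₁ + R₂ + 1)
        · rw [Set.indicator_of_mem h]; positivity
        · rw [Set.indicator_of_notMem h]
      by_cases hx : p.1 ∈ tsupport η
      · have h3 : ‖p.1 - p.2‖ ∈ Set.Iio (R₁ + R₂ + 1) := by
          have := norm_sub_le p.1 p.2
          have := hR₁ _ hp
          have := hR₂ _ hx
          simp only [Set.mem_Iio]
          linarith
        simp only [ContinuousLinearMap.mul_apply', one_mul, Set.indicator_of_mem h3]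
        refine (abs_kernel_le _ _ _).trans ?_
        gcongr
        exact hC _
      · have h3 : fderiv ℝ η p.1 = 0 := by
          have h1 := support_fderiv_subset ℝ (f := η)
          by_contra h
          exact hx (h1 h)
        simp only [hF, Function.uncurry_def, h3]
        simpa using mul_nonneg hC0 hnn
  have hswap := integral_integral_swap hFi
  have hinner : ∀ y, ∫ x, F x y = -(2 * Real.pi) * η y := by
    intro y
    rw [← integral_radial_fderiv_div_sq hη hc y, ← integral_add_left_eq_self _ y]
    congr 1
    ext z
    simp only [hF, add_sub_cancel_left]
    congr 1
    ring
  simp only [hinner] at hswap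
  rw [integral_const_mul] at hswap
  have hle : ∫ x, -(Real.sqrt ((fderiv ℝ η x (1, 0)) ^ 2 + (fderiv ℝ η x (0, 1)) ^ 2) *
      Real.sqrt (Real.pi * volume.real E)) ≤ ∫ x, ∫ y in E, F x y := by
    refine integral_mono ?_ hFi.integral_prod_left ?_
    · refine (Continuous.integrable_of_hasCompactSupport (by fun_prop) ?_).neg
      exact hs.comp_left (g := fun L : ℝ × ℝ →L[ℝ] ℝ ↦
        Real.sqrt ((L (1, 0)) ^ 2 + (L (0, 1)) ^ 2) * Real.sqrt (Real.pi * volume.real E))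
        (by simp)
    · intro x
      exact setIntegral_kernel_sub_ge _ _ hb x
  rw [hswap, integral_neg, integral_mul_const] at hle
  linarith

theorem ContinuousOn.integrable_of_isCompact_of_eq_zero {f : ℝ × ℝ → ℝ} {K : Set (ℝ × ℝ)}
    (hK : IsCompact K) (hf : ContinuousOn f K) (h0 : ∀ x ∉ K, f x = 0) : Integrable f :=
  (integrableOn_iff_integrable_of_support_subset (Function.support_subset_iff'.2 h0)).1
    (hf.integrableOn_compact hK)

theorem integral_mul_div_area_eq_neg {α : ℝ} {Ω K : Set (ℝ × ℝ)} (hΩ : IsOpen Ω)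
    (hK : IsCompact K) (hKΩ : K ⊆ Ω) {u η : ℝ × ℝ → ℝ} (hu : ContDiffOn ℝ 2 u Ω)
    (hη : ContDiff ℝ 1 η) (hηK : tsupport η ⊆ K)
    (hpde : ∀ x ∈ Ω,
      fderiv ℝ (fun y => fderiv ℝ u y (1, 0) /
          Real.sqrt (1 + (fderiv ℝ u y (1, 0)) ^ 2 + (fderiv ℝ u y (0, 1)) ^ 2)) x (1, 0)
        + fderiv ℝ (fun y => fderiv ℝ u y (0, 1) /
          Real.sqrt (1 + (fderiv ℝ u y (1, 0)) ^ 2 + (fderiv ℝ u y (0, 1)) ^ 2)) x (0, 1)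
      = α / (u x *
          Real.sqrt (1 + (fderiv ℝ u x (1, 0)) ^ 2 + (fderiv ℝ u x (0, 1)) ^ 2))) :
    ∫ x, η x * (α / (u x *
        Real.sqrt (1 + (fderiv ℝ u x (1, 0)) ^ 2 + (fderiv ℝ u x (0, 1)) ^ 2))) =
      -∫ x, (fderiv ℝ η x (1, 0) * fderiv ℝ u x (1, 0) +
          fderiv ℝ η x (0, 1) * fderiv ℝ u x (0, 1)) /
        Real.sqrt (1 + (fderiv ℝ u x (1, 0)) ^ 2 + (fderiv ℝ u x (0, 1)) ^ 2) := by
  have hDu : ContDiffOn ℝ 1 (fun x ↦ fderiv ℝ u x) Ω :=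
    hu.fderiv_of_isOpen hΩ (by norm_num)
  have hP : ContDiffOn ℝ 1 (fun x ↦ fderiv ℝ u x (1, 0)) Ω := hDu.clm_apply contDiffOn_const
  have hQ : ContDiffOn ℝ 1 (fun x ↦ fderiv ℝ u x (0, 1)) Ω := hDu.clm_apply contDiffOn_const
  have hW0 : ∀ x, (0 : ℝ) < 1 + (fderiv ℝ u x (1, 0)) ^ 2 + (fderiv ℝ u x (0, 1)) ^ 2 :=
    fun x ↦ by positivity
  have hW : ContDiffOn ℝ 1 (fun x ↦
      Real.sqrt (1 + (fderiv ℝ u x (1, 0)) ^ 2 + (fderiv ℝ u x (0, 1)) ^ 2)) Ω :=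
    ((contDiffOn_const.add (hP.pow 2)).add (hQ.pow 2)).sqrt fun x _ ↦ (hW0 x).ne'
  have hη0 : ∀ x ∉ K, η x = 0 := fun x hx ↦ image_eq_zero_of_notMem_tsupport fun h ↦ hx (hηK h)
  have hdη0 : ∀ x ∉ K, fderiv ℝ η x = 0 := fun x hx ↦ by
    by_contra h
    exact hx (hηK (support_fderiv_subset ℝ (f := η) h))
  have hdη : Continuous fun x ↦ fderiv ℝ η x := hη.continuous_fderiv one_ne_zero
  have parts : ∀ (g : ℝ × ℝ → ℝ) (v : ℝ × ℝ), ContDiffOn ℝ 1 g Ω →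
      Integrable (fun x ↦ η x * fderiv ℝ g x v) ∧ Integrable (fun x ↦ fderiv ℝ η x v * g x) ∧
      ∫ x, η x * fderiv ℝ g x v = -∫ x, fderiv ℝ η x v * g x := by
    intro g v hg
    have hdg : ContinuousOn (fun x ↦ fderiv ℝ g x v) K :=
      ((hg.continuousOn_fderiv_of_isOpen hΩ le_rfl).clm_apply continuousOn_const).mono hKΩ
    have hgK := hg.continuousOn.mono hKΩ
    have i1 : Integrable (fun x ↦ η x * fderiv ℝ g x v) :=
      ContinuousOn.integrable_of_isCompact_of_eq_zero hK (hη.continuous.continuousOn.mul hdg)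
        fun x hx ↦ by simp [hη0 x hx]
    have i2 : Integrable (fun x ↦ fderiv ℝ η x v * g x) :=
      ContinuousOn.integrable_of_isCompact_of_eq_zero hK
        (ContinuousOn.mul (by fun_prop) hgK) fun x hx ↦ by simp [hdη0 x hx]
    refine ⟨i1, i2, integral_mul_fderiv_eq_neg_fderiv_mul_of_integrable i2 i1 ?_ ?_ ?_⟩
    · exact ContinuousOn.integrable_of_isCompact_of_eq_zero hK
        (hη.continuous.continuousOn.mul hgK) fun x hx ↦ by simp [hη0 x hx]
    · exact fun x _ ↦ hη.differentiable one_ne_zero x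
    · exact fun x hx ↦ (hg.contDiffAt (hΩ.mem_nhds (hKΩ (hηK hx)))).differentiableAt one_ne_zero
  obtain ⟨a1, b1, e1⟩ := parts _ (1, 0) (hP.div hW fun x _ ↦ (Real.sqrt_pos.2 (hW0 x)).ne')
  obtain ⟨a2, b2, e2⟩ := parts _ (0, 1) (hQ.div hW fun x _ ↦ (Real.sqrt_pos.2 (hW0 x)).ne')
  have e3 := congrArg₂ (· + ·) e1 e2
  beta_reduce at e3
  rw [← integral_add a1 a2, ← neg_add, ← integral_add b1 b2] at e3
  convert e3 using 1
  · congr 1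
    ext x
    by_cases hx : x ∈ K
    · rw [← hpde x (hKΩ hx), mul_add]
      rfl
    · simp [hη0 x hx]
  · congr 2
    ext x
    simp only [Pi.div_apply]
    ring

theorem IsCompact.superlevel {Ω : Set (ℝ × ℝ)} (hΩbdd : Bornology.IsBounded Ω)
    {u : ℝ × ℝ → ℝ} (hu : ContinuousOn u (closure Ω)) (t : ℝ) :
    IsCompact {x | x ∈ closure Ω ∧ t ≤ u x} := by
  have h1 : IsCompact (closure Ω) := hΩbdd.isCompact_closure
  exact h1.of_isClosed_subset (hu.preimage_isClosed_of_isClosed isClosed_closure isClosed_Ici)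
    fun x hx ↦ hx.1

theorem superlevel_subset {Ω : Set (ℝ × ℝ)} (hΩ : IsOpen Ω) {u : ℝ × ℝ → ℝ} {c t : ℝ}
    (hbd : ∀ x ∈ frontier Ω, u x = c) (ht : c < t) :
    {x | x ∈ closure Ω ∧ t ≤ u x} ⊆ Ω := by
  rintro x ⟨hx, hxt⟩
  by_contra h
  have := hbd x ⟨hx, by rwa [hΩ.interior_eq]⟩
  linarith

/-- Truncating a function below a level that exceeds its boundary values gives a compactly
supported function. -/
theorem indicator_comp_superlevel {Ω K : Set (ℝ × ℝ)} (hΩ : IsOpen Ω) (hK : IsClosed K)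
    (hKΩ : K ⊆ Ω) {u : ℝ × ℝ → ℝ} (hu : ContDiffOn ℝ 1 u Ω) {θ ρ : ℝ → ℝ}
    (hθ : ContDiff ℝ 1 θ) (hθρ : ∀ s, HasDerivAt θ (ρ s) s)
    (h0 : ∀ x ∈ Ω, x ∉ K → θ (u x) = 0) :
    ContDiff ℝ 1 (Ω.indicator fun x ↦ θ (u x)) ∧
    tsupport (Ω.indicator fun x ↦ θ (u x)) ⊆ K ∧
    (∀ x ∈ Ω, ∀ v, fderiv ℝ (Ω.indicator fun x ↦ θ (u x)) x v = ρ (u x) * fderiv ℝ u x v) ∧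
    (∀ x ∉ K, ∀ v, fderiv ℝ (Ω.indicator fun x ↦ θ (u x)) x v = 0) := by
  have hz : ∀ x ∉ K, (Ω.indicator fun x ↦ θ (u x)) x = 0 := by
    intro x hx
    by_cases h : x ∈ Ω
    · rw [Set.indicator_of_mem h, h0 x h hx]
    · exact Set.indicator_of_notMem h _
  have heq : ∀ x ∈ Ω, (Ω.indicator fun x ↦ θ (u x)) =ᶠ[nhds x] fun x ↦ θ (u x) := by
    intro x hx
    filter_upwards [hΩ.mem_nhds hx] with y hy
    exact Set.indicator_of_mem hy _
  have hsupp : tsupport (Ω.indicator fun x ↦ θ (u x)) ⊆ K :=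
    closure_minimal (Function.support_subset_iff'.2 hz) hK
  refine ⟨?_, hsupp, ?_, ?_⟩
  · refine contDiff_iff_contDiffAt.2 fun x ↦ ?_
    by_cases hx : x ∈ Ω
    · exact (hθ.contDiffAt.comp x (hu.contDiffAt (hΩ.mem_nhds hx))).congr_of_eventuallyEq
        (heq x hx)
    · refine (contDiffAt_const (c := (0 : ℝ))).congr_of_eventuallyEq ?_
      filter_upwards [hK.isOpen_compl.mem_nhds fun h ↦ hx (hKΩ h)] with y hy
      exact hz y hy
  · intro x hx v
    have h1 : HasFDerivAt (fun x ↦ θ (u x)) (ρ (u x) • fderiv ℝ u x) x :=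
      (hθρ (u x)).comp_hasFDerivAt x
        ((hu.contDiffAt (hΩ.mem_nhds hx)).differentiableAt one_ne_zero).hasFDerivAt
    rw [(heq x hx).fderiv_eq, h1.fderiv]
    simp
  · intro x hx v
    have : fderiv ℝ (Ω.indicator fun x ↦ θ (u x)) x = 0 := by
      by_contra h
      exact hx (hsupp (support_fderiv_subset ℝ h))
    simp [this]

/-- The area element `√(1 + |Du|²)` of the graph of `u`. -/
noncomputable def areaElement (u : ℝ × ℝ → ℝ) (x : ℝ × ℝ) : ℝ :=
  Real.sqrt (1 + (fderiv ℝ u x (1, 0)) ^ 2 + (fderiv ℝ u x (0, 1)) ^ 2)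

theorem one_le_areaElement (u : ℝ × ℝ → ℝ) (x : ℝ × ℝ) : 1 ≤ areaElement u x :=
  Real.one_le_sqrt.2 <| by
    rw [add_assoc, le_add_iff_nonneg_right]
    positivity

theorem isOpen_superlevel {Ω : Set (ℝ × ℝ)} (hΩ : IsOpen Ω) {u : ℝ × ℝ → ℝ}
    (hu : ContinuousOn u Ω) (s : ℝ) : IsOpen {x | x ∈ Ω ∧ s < u x} :=
  hu.isOpen_inter_preimage hΩ isOpen_Ioi

theorem level_set_inequality_of_cutoff {α c : ℝ} (hα : α < 0) (hc : 0 < c)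
    {Ω : Set (ℝ × ℝ)} (hΩ : IsOpen Ω) (hΩbdd : Bornology.IsBounded Ω)
    {u : ℝ × ℝ → ℝ} (huc : ContinuousOn u (closure Ω)) (hu : ContDiffOn ℝ 2 u Ω)
    (hbd : ∀ x ∈ frontier Ω, u x = c)
    (hW : IntegrableOn (areaElement u) Ω)
    (hpde : ∀ x ∈ Ω,
      fderiv ℝ (fun y => fderiv ℝ u y (1, 0) / areaElement u y) x (1, 0)
        + fderiv ℝ (fun y => fderiv ℝ u y (0, 1) / areaElement u y) x (0, 1)
      = α / (u x * areaElement u x))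
    {t t' m : ℝ} (ht : c < t) (htt' : t ≤ t') {θ ρ : ℝ → ℝ} (hρ : Continuous ρ)
    (hθρ : ∀ s, HasDerivAt θ (ρ s) s) (hρ0 : ∀ s, 0 ≤ ρ s) (hρ1 : ∀ s, ρ s ≤ 1)
    (hρt : ∀ s ≤ t, ρ s = 0) (hρt' : ∀ s, t' < s → ρ s = 0)
    (hθt : ∀ s ≤ t, θ s = 0) (hθt' : ∀ s, t' < s → θ s = m) (hm : 0 < m) :
    4 * Real.pi * m * t * volume.real {x | x ∈ Ω ∧ t' < u x} ≤
      -α * volume.real {x | x ∈ Ω ∧ t < u x} *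
        ((∫ x in {x | x ∈ Ω ∧ t < u x}, areaElement u x) -
          ∫ x in {x | x ∈ Ω ∧ t' < u x}, areaElement u x) := by
  have ht0 : 0 < t := hc.trans ht
  set K := {x | x ∈ closure Ω ∧ t ≤ u x} with hKdef
  have hK : IsCompact K := IsCompact.superlevel hΩbdd huc t
  have hKΩ : K ⊆ Ω := superlevel_subset hΩ hbd ht
  have hKm : MeasurableSet K := hK.isClosed.measurableSet
  have hmono : Monotone θ := monotone_of_deriv_nonneg (fun s ↦ (hθρ s).differentiableAt)
    fun s ↦ by rw [(hθρ s).deriv]; exact hρ0 s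
  have hθ0 : ∀ s, 0 ≤ θ s := fun s ↦ by
    rw [← hθt (min s t) (min_le_right _ _)]
    exact hmono (min_le_left _ _)
  have hθm : ∀ s, θ s ≤ m := fun s ↦ by
    rw [← hθt' (max s (t' + 1)) (by linarith [le_max_right s (t' + 1)])]
    exact hmono (le_max_left _ _)
  have hθ : ContDiff ℝ 1 θ := by
    rw [contDiff_one_iff_deriv]
    refine ⟨fun s ↦ (hθρ s).differentiableAt, ?_⟩
    rwa [show deriv θ = ρ from funext fun s ↦ (hθρ s).deriv]
  have hnotK : ∀ x ∈ Ω, x ∉ K → u x < t := fun x hx hxK ↦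
    lt_of_not_ge fun h ↦ hxK ⟨subset_closure hx, h⟩
  obtain ⟨hη, hηK, hdη, hdη0⟩ := indicator_comp_superlevel hΩ hK.isClosed hKΩ
    (hu.of_le (by norm_num)) hθ hθρ fun x hx hxK ↦ hθt _ (hnotK x hx hxK).le
  set η := Ω.indicator fun x ↦ θ (u x) with hηdef
  have hηc : HasCompactSupport η := hK.of_isClosed_subset (isClosed_tsupport _) hηK
  have hDu : ContDiffOn ℝ 1 (fun x ↦ fderiv ℝ u x) Ω :=
    hu.fderiv_of_isOpen hΩ (by norm_num)
  have hP : ContinuousOn (fun x ↦ fderiv ℝ u x (1, 0)) K :=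
    (hDu.continuousOn.clm_apply continuousOn_const).mono hKΩ
  have hQ : ContinuousOn (fun x ↦ fderiv ℝ u x (0, 1)) K :=
    (hDu.continuousOn.clm_apply continuousOn_const).mono hKΩ
  have hWK : ContinuousOn (areaElement u) K :=
    ((continuousOn_const.add (hP.pow 2)).add (hQ.pow 2)).sqrt
  have hρK : ContinuousOn (fun x ↦ ρ (u x)) K :=
    hρ.comp_continuousOn (hu.continuousOn.mono hKΩ)
  have hWpos : ∀ x, 0 < areaElement u x := fun x ↦
    zero_lt_one.trans_le (one_le_areaElement u x)
  set G : ℝ × ℝ → ℝ := fun x ↦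
    Real.sqrt ((fderiv ℝ u x (1, 0)) ^ 2 + (fderiv ℝ u x (0, 1)) ^ 2) with hG
  have hGsq : ∀ x, G x ^ 2 = (fderiv ℝ u x (1, 0)) ^ 2 + (fderiv ℝ u x (0, 1)) ^ 2 :=
    fun x ↦ Real.sq_sqrt (by positivity)
  have hGK : ContinuousOn G K := ((hP.pow 2).add (hQ.pow 2)).sqrt
  have iS : IntegrableOn (fun x ↦ ρ (u x) * (G x ^ 2 / areaElement u x)) K :=
    (hρK.mul ((hGK.pow 2).div hWK fun x _ ↦ (hWpos x).ne')).integrableOn_compact hK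
  have iQ : IntegrableOn (fun x ↦ ρ (u x) * G x) K := (hρK.mul hGK).integrableOn_compact hK
  have iR : IntegrableOn (fun x ↦ ρ (u x) * areaElement u x) K :=
    (hρK.mul hWK).integrableOn_compact hK
  set S := ∫ x in K, ρ (u x) * (G x ^ 2 / areaElement u x) with hS
  set Q := ∫ x in K, ρ (u x) * G x with hQdef
  set R := ∫ x in K, ρ (u x) * areaElement u x with hR
  have ho := fun s ↦ isOpen_superlevel hΩ hu.continuousOn s
  have hbdd : ∀ s, Bornology.IsBounded {x | x ∈ Ω ∧ s < u x} :=
    fun s ↦ hΩbdd.subset fun x hx ↦ hx.1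
  set E := {x | x ∈ Ω ∧ t < u x} with hE
  set E' := {x | x ∈ Ω ∧ t' < u x} with hE'
  have hE'E : E' ⊆ E := fun x hx ↦ ⟨hx.1, htt'.trans_lt hx.2⟩
  have isoperimetric : 2 * Real.pi * (m * volume.real E') ≤
      Real.sqrt (Real.pi * volume.real E') * Q := by
    have h1 := two_pi_mul_setIntegral_le hη hηc (ho t').measurableSet (hbdd t')
    have h2 : ∫ y in E', η y = m * volume.real E' := by
      rw [setIntegral_congr_fun (g := fun _ ↦ m) (ho t').measurableSet, setIntegral_const,
        smul_eq_mul, mul_comm]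
      intro x hx
      simp only [hηdef, Set.indicator_of_mem hx.1]
      exact hθt' _ hx.2
    have h3 : ∫ x, Real.sqrt ((fderiv ℝ η x (1, 0)) ^ 2 + (fderiv ℝ η x (0, 1)) ^ 2) = Q := by
      rw [← setIntegral_eq_integral_of_forall_compl_eq_zero (s := K)]
      · refine setIntegral_congr_fun hKm fun x hx ↦ ?_
        simp only [hdη x (hKΩ hx), hG]
        rw [mul_pow, mul_pow, ← mul_add, Real.sqrt_mul (sq_nonneg _), Real.sqrt_sq (hρ0 _)]
      · intro x hx
        simp [hdη0 x hx]
    rwa [h2, h3] at h1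
  have divergence : S ≤ -α * m / t * volume.real E := by
    have h1 : ∫ x, η x * (α / (u x * areaElement u x)) =
        -∫ x, (fderiv ℝ η x (1, 0) * fderiv ℝ u x (1, 0) +
          fderiv ℝ η x (0, 1) * fderiv ℝ u x (0, 1)) / areaElement u x :=
      integral_mul_div_area_eq_neg hΩ hK hKΩ hu hη hηK hpde
    have h2 : ∫ x, (fderiv ℝ η x (1, 0) * fderiv ℝ u x (1, 0) +
          fderiv ℝ η x (0, 1) * fderiv ℝ u x (0, 1)) / areaElement u x = S := by
      rw [← setIntegral_eq_integral_of_forall_compl_eq_zero (s := K)]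
      · refine setIntegral_congr_fun hKm fun x hx ↦ ?_
        simp only [hdη x (hKΩ hx), hGsq]
        ring
      · intro x hx
        simp [hdη0 x hx]
    have h3 : S = ∫ x, η x * (-α / (u x * areaElement u x)) := by
      rw [← h2, ← neg_eq_iff_eq_neg.2 h1, ← integral_neg]
      congr 1
      ext x
      ring
    have h4 : ∫ x, E.indicator (fun _ ↦ -α * m / t) x = -α * m / t * volume.real E := by
      rw [integral_indicator (ho t).measurableSet, setIntegral_const, smul_eq_mul, mul_comm]
    rw [h3, ← h4]
    have hz : ∀ x ∉ E, η x = 0 := fun x hx ↦ by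
      by_cases h : x ∈ Ω
      · simp only [hηdef, Set.indicator_of_mem h]
        exact hθt _ (le_of_not_gt fun h' ↦ hx ⟨h, h'⟩)
      · exact Set.indicator_of_notMem h _
    have hpt : ∀ x ∈ E, 0 ≤ η x * (-α / (u x * areaElement u x)) ∧
        η x * (-α / (u x * areaElement u x)) ≤ -α * m / t := by
      intro x hx
      have hηx : η x = θ (u x) := Set.indicator_of_mem hx.1 _
      have h5 : t ≤ u x * areaElement u x := by
        nlinarith [one_le_areaElement u x, hx.2]
      have h6 : 0 < u x * areaElement u x := ht0.trans_le h5
      have hα' : 0 < -α := by linarith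
      rw [hηx]
      refine ⟨mul_nonneg (hθ0 _) (by positivity), ?_⟩
      calc θ (u x) * (-α / (u x * areaElement u x)) ≤ m * (-α / t) := by
            gcongr
            exact hθm _
        _ = -α * m / t := by ring
    refine integral_mono_of_nonneg (.of_forall fun x ↦ ?_) ?_ (.of_forall fun x ↦ ?_)
    · by_cases hx : x ∈ E
      · exact (hpt x hx).1
      · simp [hz x hx]
    · exact (integrableOn_const (hbdd t).measure_lt_top.ne).integrable_indicator
        (ho t).measurableSet
    · by_cases hx : x ∈ E
      · simpa only [Set.indicator_of_mem hx] using (hpt x hx).2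
      · simp [hz x hx, hx]
  have cauchy_schwarz : Q ^ 2 ≤ S * R := by
    have h1 : ∀ y : ℝ, 0 ≤ S * (y * y) + (-2 * Q) * y + R := by
      intro y
      have h2 : S * (y * y) + (-2 * Q) * y + R =
          ∫ x in K, (ρ (u x) * (G x ^ 2 / areaElement u x) * (y * y) +
            -2 * (ρ (u x) * G x) * y + ρ (u x) * areaElement u x) := by
        have i12 : IntegrableOn (fun x ↦ ρ (u x) * (G x ^ 2 / areaElement u x) * (y * y) +
            -2 * (ρ (u x) * G x) * y) K :=
          (iS.mul_const (y * y)).add ((iQ.const_mul (-2)).mul_const y)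
        rw [integral_add i12 iR, integral_add (iS.mul_const _) ((iQ.const_mul _).mul_const _),
          integral_mul_const, integral_mul_const, integral_const_mul]
      rw [h2]
      refine integral_nonneg fun x ↦ ?_
      have h3 := hWpos x
      have h4 : ρ (u x) * (G x ^ 2 / areaElement u x) * (y * y) +
            -2 * (ρ (u x) * G x) * y + ρ (u x) * areaElement u x =
          ρ (u x) * ((y * G x - areaElement u x) ^ 2 / areaElement u x) := by
        field_simp
        ring
      simp only [h4, Pi.zero_apply]
      have := hρ0 (u x)
      positivity
    have := discrim_le_zero h1
    rw [discrim] at this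
    linarith
  have coarea : R ≤ (∫ x in E, areaElement u x) - ∫ x in E', areaElement u x := by
    rw [← setIntegral_sdiff (ho t').measurableSet (hW.mono_set fun x (hx : x ∈ E) ↦ hx.1) hE'E]
    have h1 : R = ∫ x in E \ E', ρ (u x) * areaElement u x := by
      have hsub : E \ E' ⊆ K := fun x hx ↦ ⟨subset_closure hx.1.1, hx.1.2.le⟩
      refine (setIntegral_eq_of_subset_of_forall_sdiff_eq_zero (μ := volume)
        (f := fun x ↦ ρ (u x) * areaElement u x) hKm hsub ?_)
      rintro x ⟨hxK, hx⟩
      have : ρ (u x) = 0 := by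
        by_contra h
        have h1 : t < u x := lt_of_not_ge fun h' ↦ h (hρt _ h')
        exact hx ⟨⟨hKΩ hxK, h1⟩, fun h' ↦ h (hρt' _ h'.2)⟩
      simp [this]
    rw [h1]
    refine setIntegral_mono_on ?_ (hW.mono_set fun x (hx : x ∈ E \ E') ↦ hx.1.1)
      ((ho t).measurableSet.diff (ho t').measurableSet) fun x _ ↦
        mul_le_of_le_one_left (hWpos x).le (hρ1 _)
    exact iR.mono_set fun x (hx : x ∈ E \ E') ↦ ⟨subset_closure hx.1.1, hx.1.2.le⟩
  have hR0 : 0 ≤ R := integral_nonneg fun x ↦ mul_nonneg (hρ0 _) (hWpos x).le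
  set μ' := volume.real E' with hμ'
  set μ := volume.real E with hμ
  have hμ0 : 0 ≤ μ := measureReal_nonneg
  have hα' : 0 < -α := by linarith
  refine le_trans ?_ (mul_le_mul_of_nonneg_left coarea (by positivity))
  have hμ'0 : 0 ≤ μ' := measureReal_nonneg
  rcases hμ'0.eq_or_lt with h0 | h0
  · rw [← h0, mul_zero]
    positivity
  · have h1 : (2 * Real.pi * (m * μ')) ^ 2 ≤ (Real.sqrt (Real.pi * μ') * Q) ^ 2 := by
      gcongr
    rw [mul_pow _ Q, Real.sq_sqrt (by positivity)] at h1
    have h2 : Real.pi * μ' * Q ^ 2 ≤ Real.pi * μ' * ((-α * m / t * μ) * R) := by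
      gcongr
      exact cauchy_schwarz.trans (mul_le_mul_of_nonneg_right divergence hR0)
    have h3 : (Real.pi * μ' * m / t) * (4 * Real.pi * m * t * μ') ≤
        (Real.pi * μ' * m / t) * (-α * μ * R) := by
      calc _ = (2 * Real.pi * (m * μ')) ^ 2 := by field_simp; ring
        _ ≤ _ := h1.trans h2
        _ = _ := by ring
    exact le_of_mul_le_mul_left h3 (by positivity)

theorem exists_trapezoidal_cutoff {t t' δ : ℝ} (hδ : 0 < δ) (htt' : 2 * δ < t' - t) :
    ∃ (θ ρ : ℝ → ℝ) (m : ℝ), Continuous ρ ∧ (∀ s, HasDerivAt θ (ρ s) s) ∧ (∀ s, 0 ≤ ρ s) ∧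
      (∀ s, ρ s ≤ 1) ∧ (∀ s ≤ t, ρ s = 0) ∧ (∀ s, t' < s → ρ s = 0) ∧ (∀ s ≤ t, θ s = 0) ∧
      (∀ s, t' < s → θ s = m) ∧ t' - t - 2 * δ ≤ m := by
  set ρ : ℝ → ℝ := fun s ↦ max 0 (min 1 (min ((s - t) / δ) ((t' - s) / δ))) with hρ
  have hρc : Continuous ρ := by fun_prop
  have hi : ∀ a b, IntervalIntegrable ρ volume a b := fun a b ↦ hρc.intervalIntegrable a b
  have hρ0 : ∀ s, 0 ≤ ρ s := fun s ↦ le_max_left _ _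
  have hρt : ∀ s ≤ t, ρ s = 0 := fun s hs ↦ max_eq_left <|
    (min_le_right _ _).trans <| (min_le_left _ _).trans <|
      div_nonpos_of_nonpos_of_nonneg (by linarith) hδ.le
  have hρt' : ∀ s, t' ≤ s → ρ s = 0 := fun s hs ↦ max_eq_left <|
    (min_le_right _ _).trans <| (min_le_right _ _).trans <|
      div_nonpos_of_nonpos_of_nonneg (by linarith) hδ.le
  have hone : ∀ s ∈ Set.Icc (t + δ) (t' - δ), 1 ≤ ρ s := fun s hs ↦
    le_max_of_le_right <| le_min le_rfl <| le_min ((one_le_div hδ).2 (by linarith [hs.1]))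
      ((one_le_div hδ).2 (by linarith [hs.2]))
  refine ⟨fun s ↦ ∫ r in t..s, ρ r, ρ, ∫ r in t..t', ρ r, hρc,
    fun s ↦ hρc.integral_hasStrictDerivAt t s |>.hasDerivAt, hρ0,
    fun s ↦ max_le zero_le_one (min_le_left _ _), hρt, fun s hs ↦ hρt' s hs.le, ?_, ?_, ?_⟩
  · intro s hs
    refine intervalIntegral.integral_zero_ae (.of_forall fun r hr ↦ ?_)
    rw [Set.uIoc_of_ge hs] at hr
    exact hρt r hr.2
  · intro s hs
    have h0 : ∫ r in t'..s, ρ r = 0 := by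
      refine intervalIntegral.integral_zero_ae (.of_forall fun r hr ↦ ?_)
      rw [Set.uIoc_of_le hs.le] at hr
      exact hρt' r hr.1.le
    have := intervalIntegral.integral_add_adjacent_intervals (hi t t') (hi t' s)
    dsimp only
    linarith
  · calc t' - t - 2 * δ = ∫ r in (t + δ)..(t' - δ), (1 : ℝ) := by
          rw [intervalIntegral.integral_const, smul_eq_mul]; ring
      _ ≤ ∫ r in (t + δ)..(t' - δ), ρ r :=
          intervalIntegral.integral_mono_on (by linarith) intervalIntegrable_const (hi _ _) hone
      _ ≤ ∫ r in t..t', ρ r :=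
          intervalIntegral.integral_mono_interval (by linarith) (by linarith) (by linarith)
            (.of_forall hρ0) (hi _ _)

/-- A telescoping form of the differential inequality for the area above a level. -/
theorem sq_sub_sq_le_of_level_inequality {κ a b : ℝ} (hκ : 0 ≤ κ) (ha : 0 < a) (hab : a < b)
    {A μ : ℝ → ℝ} (hμ : ∀ s ∈ Set.Icc a b, 0 < μ s)
    (hanti : AntitoneOn μ (Set.Icc a b))
    (h : ∀ s ∈ Set.Icc a b, ∀ s' ∈ Set.Icc a b, s ≤ s' →
      κ * (s' - s) * s * μ s' ≤ μ s * (A s - A s')) :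
    κ * ((b ^ 2 - a ^ 2) / 2) ≤ A a - A b := by
  have step : ∀ ε : ℝ, 0 < ε → ∀ i : ℕ, a + i * ε ≤ b →
      κ * (((a + i * ε) ^ 2 - a ^ 2) / 2 - i * ε ^ 2 / 2 -
        ε * b * (Real.log (μ a) - Real.log (μ (a + i * ε)))) ≤ A a - A (a + i * ε) := by
    intro ε hε i
    induction i with
    | zero => intro _; simp
    | succ i ih =>
      intro hi
      push_cast at hi ⊢
      have hs : a + i * ε ∈ Set.Icc a b := ⟨by nlinarith [(Nat.cast_nonneg i : (0 : ℝ) ≤ i)],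
        by linarith⟩
      have hs' : a + (i + 1) * ε ∈ Set.Icc a b := ⟨by linarith [hs.1], hi⟩
      have h0 := ih hs.2
      have h1 := h _ hs _ hs' (by linarith)
      set s := a + i * ε with hsdef
      have hss : a + (i + 1) * ε = s + ε := by rw [hsdef]; ring
      rw [hss] at h1 hs' ⊢
      have p := hμ _ hs
      have p' := hμ _ hs'
      have h2 : κ * ε * s * (μ (s + ε) / μ s) ≤ A s - A (s + ε) := by
        rw [← mul_div_assoc, div_le_iff₀ p]
        linarith
      have h3 : 1 + (Real.log (μ (s + ε)) - Real.log (μ s)) ≤ μ (s + ε) / μ s := by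
        have := Real.log_le_sub_one_of_pos (div_pos p' p)
        rw [Real.log_div p'.ne' p.ne'] at this
        linarith
      have h4 : Real.log (μ (s + ε)) - Real.log (μ s) ≤ 0 :=
        sub_nonpos.2 (Real.log_le_log p' (hanti hs hs' (by linarith)))
      have h5 : s + b * (Real.log (μ (s + ε)) - Real.log (μ s)) ≤ s * (μ (s + ε) / μ s) := by
        nlinarith [mul_le_mul_of_nonneg_left h3 (ha.le.trans hs.1),
          mul_le_mul_of_nonpos_right hs.2 h4]
      have h6 := mul_le_mul_of_nonneg_left h5 (mul_nonneg hκ hε.le)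
      rw [← mul_assoc] at h6
      linear_combination h0 + h2 + h6
  have hn : ∀ n : ℕ, κ * ((b ^ 2 - a ^ 2) / 2 - ((b - a) ^ 2 / 2 +
      (b - a) * b * (Real.log (μ a) - Real.log (μ b))) / (n + 1)) ≤ A a - A b := by
    intro n
    have hn0 : (0 : ℝ) < n + 1 := by positivity
    have he : a + (n + 1 : ℕ) * ((b - a) / (n + 1)) = b := by
      push_cast
      field_simp
      ring
    have := step ((b - a) / (n + 1)) (div_pos (by linarith) hn0) (n + 1) he.le
    rw [he] at this
    refine le_of_eq_of_le ?_ this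
    push_cast
    field_simp
    ring
  set C := (b - a) ^ 2 / 2 + (b - a) * b * (Real.log (μ a) - Real.log (μ b))
  have hlim : Filter.Tendsto (fun n : ℕ ↦ κ * ((b ^ 2 - a ^ 2) / 2 - C / (n + 1)))
      Filter.atTop (nhds (κ * ((b ^ 2 - a ^ 2) / 2))) := by
    have := (((tendsto_one_div_add_atTop_nhds_zero_nat (𝕜 := ℝ)).const_mul C).const_sub
      ((b ^ 2 - a ^ 2) / 2)).const_mul κ
    simpa only [mul_one_div, mul_zero, sub_zero] using this
  exact le_of_tendsto' hlim hn

theorem level_set_inequality {α c : ℝ} (hα : α < 0) (hc : 0 < c)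
    {Ω : Set (ℝ × ℝ)} (hΩ : IsOpen Ω) (hΩbdd : Bornology.IsBounded Ω)
    {u : ℝ × ℝ → ℝ} (huc : ContinuousOn u (closure Ω)) (hu : ContDiffOn ℝ 2 u Ω)
    (hbd : ∀ x ∈ frontier Ω, u x = c)
    (hW : IntegrableOn (areaElement u) Ω)
    (hpde : ∀ x ∈ Ω,
      fderiv ℝ (fun y => fderiv ℝ u y (1, 0) / areaElement u y) x (1, 0)
        + fderiv ℝ (fun y => fderiv ℝ u y (0, 1) / areaElement u y) x (0, 1)
      = α / (u x * areaElement u x))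
    {t t' : ℝ} (ht : c < t) (htt' : t ≤ t') :
    4 * Real.pi * (t' - t) * t * volume.real {x | x ∈ Ω ∧ t' < u x} ≤
      -α * volume.real {x | x ∈ Ω ∧ t < u x} *
        ((∫ x in {x | x ∈ Ω ∧ t < u x}, areaElement u x) -
          ∫ x in {x | x ∈ Ω ∧ t' < u x}, areaElement u x) := by
  rcases htt'.eq_or_lt with rfl | hlt
  · simp
  set μ' := volume.real {x | x ∈ Ω ∧ t' < u x} with hμ'
  have hμ'0 : 0 ≤ μ' := measureReal_nonneg
  have ht0 : 0 < t := hc.trans ht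
  have hlim : Filter.Tendsto (fun δ : ℝ ↦ 4 * Real.pi * (t' - t - 2 * δ) * t * μ')
      (nhdsWithin 0 (Set.Ioi 0)) (nhds (4 * Real.pi * (t' - t) * t * μ')) := by
    have : Continuous fun δ : ℝ ↦ 4 * Real.pi * (t' - t - 2 * δ) * t * μ' := by fun_prop
    simpa using (this.tendsto 0).mono_left nhdsWithin_le_nhds
  refine le_of_tendsto hlim ?_
  filter_upwards [Ioo_mem_nhdsGT (show 0 < (t' - t) / 2 by linarith)] with δ hδ
  obtain ⟨θ, ρ, m, h1, h2, h3, h4, h5, h6, h7, h8, h9⟩ :=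
    exists_trapezoidal_cutoff hδ.1 (show 2 * δ < t' - t by linarith [hδ.2])
  refine le_trans ?_ (level_set_inequality_of_cutoff hα hc hΩ hΩbdd huc hu hbd hW hpde ht htt'
    h1 h2 h3 h4 h5 h6 h7 h8 (by linarith [hδ.2]))
  gcongr

theorem exists_norm_fderiv_le {Ω : Set (ℝ × ℝ)} (hΩ : IsOpen Ω) (hΩbdd : Bornology.IsBounded Ω)
    {u : ℝ × ℝ → ℝ} (hu : ContDiffOn ℝ 2 u (closure Ω)) :
    ∃ C, ∀ x ∈ Ω, ‖fderiv ℝ u x‖ ≤ C := by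
  have hK : IsCompact (closure Ω) := hΩbdd.isCompact_closure
  suffices H : ∃ C, ∀ x ∈ closure Ω, x ∈ Ω → ‖fderiv ℝ u x‖ ≤ C by
    obtain ⟨C, hC⟩ := H
    exact ⟨C, fun x hx ↦ hC x (subset_closure hx) hx⟩
  refine hK.induction_on (p := fun s ↦ ∃ C, ∀ x ∈ s, x ∈ Ω → ‖fderiv ℝ u x‖ ≤ C)
    ⟨0, by simp⟩ ?_ ?_ ?_
  · rintro s t hst ⟨C, hC⟩
    exact ⟨C, fun x hx ↦ hC x (hst hx)⟩
  · rintro s t ⟨C, hC⟩ ⟨D, hD⟩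
    exact ⟨max C D, fun x hx hxΩ ↦ hx.elim (fun h ↦ (hC x h hxΩ).trans (le_max_left _ _))
      fun h ↦ (hD x h hxΩ).trans (le_max_right _ _)⟩
  · intro x hx
    have h1 : ContDiffWithinAt ℝ (1 + 1) u (closure Ω) x := by
      simpa only [one_add_one_eq_two] using hu x hx
    obtain ⟨v, hv, -, -, f', hf', hf'c⟩ :=
      (contDiffWithinAt_succ_iff_hasFDerivWithinAt' (by simp)).1 h1
    rw [Set.insert_eq_of_mem hx] at hv
    have h2 := hf'c.continuousWithinAt.norm.eventually_lt_const (lt_add_one ‖f' x‖)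
    refine ⟨_, Filter.inter_mem hv h2, ‖f' x‖ + 1, fun y hy hyΩ ↦ ?_⟩
    rw [((hf' y hy.1).hasFDerivAt (Filter.mem_of_superset (hΩ.mem_nhds hyΩ)
      subset_closure)).fderiv]
    exact hy.2.le

theorem integrableOn_areaElement {Ω : Set (ℝ × ℝ)} (hΩ : IsOpen Ω)
    (hΩbdd : Bornology.IsBounded Ω) {u : ℝ × ℝ → ℝ} (hu : ContDiffOn ℝ 2 u (closure Ω)) :
    IntegrableOn (areaElement u) Ω := by
  obtain ⟨C, hC⟩ := exists_norm_fderiv_le hΩ hΩbdd hu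
  have hDu : ContinuousOn (fun x ↦ fderiv ℝ u x) Ω :=
    (hu.mono subset_closure).continuousOn_fderiv_of_isOpen hΩ (by norm_num)
  have hWc : ContinuousOn (areaElement u) Ω :=
    ((continuousOn_const.add ((hDu.clm_apply continuousOn_const).pow 2)).add
      ((hDu.clm_apply continuousOn_const).pow 2)).sqrt
  refine IntegrableOn.of_bound hΩbdd.measure_lt_top (hWc.aestronglyMeasurable hΩ.measurableSet)
    (Real.sqrt (1 + C ^ 2 + C ^ 2)) ((ae_restrict_iff' hΩ.measurableSet).2 (.of_forall ?_))
  intro x hx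
  have hpart : ∀ v : ℝ × ℝ, ‖v‖ = 1 → (fderiv ℝ u x v) ^ 2 ≤ C ^ 2 := fun v hv ↦ by
    have := (fderiv ℝ u x).le_opNorm v
    rw [hv, mul_one] at this
    exact sq_le_sq.2 ((this.trans (hC x hx)).trans (le_abs_self C))
  rw [areaElement, Real.norm_of_nonneg (Real.sqrt_nonneg _)]
  exact Real.sqrt_le_sqrt (add_le_add (add_le_add le_rfl (hpart _ (by simp [Prod.norm_def])))
    (hpart _ (by simp [Prod.norm_def])))

/-- Lower area estimate for `α`-singular minimal graphs, `α < 0`. The surface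
is the graph `z = u(x,y)` over a bounded domain `Ω`, lying above the plane
`z = c` with boundary in that plane, of maximal height `h`, satisfying the
singular minimal graph equation `div(Du/√(1+|Du|²)) = α/(u√(1+|Du|²))`.
Then its area `∫_Ω √(1+|Du|²)` is at least `-(2π/α)(h² - c²)`. -/
theorem stmt_13 (α c : ℝ) (hα : α < 0) (hc : 0 < c)
    (Ω : Set (ℝ × ℝ)) (hΩopen : IsOpen Ω) (hΩbdd : Bornology.IsBounded Ω)
    (hΩne : Ω.Nonempty)
    (u : ℝ × ℝ → ℝ) (hu : ContDiffOn ℝ 2 u (closure Ω))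
    (hbd : ∀ x ∈ frontier Ω, u x = c)
    (hge : ∀ x ∈ closure Ω, c ≤ u x)
    (h : ℝ) (hh : IsGreatest (u '' closure Ω) h)
    (hpde : ∀ x ∈ Ω,
      fderiv ℝ (fun y => fderiv ℝ u y (1, 0) /
          Real.sqrt (1 + (fderiv ℝ u y (1, 0)) ^ 2 + (fderiv ℝ u y (0, 1)) ^ 2)) x (1, 0)
        + fderiv ℝ (fun y => fderiv ℝ u y (0, 1) /
          Real.sqrt (1 + (fderiv ℝ u y (1, 0)) ^ 2 + (fderiv ℝ u y (0, 1)) ^ 2)) x (0, 1)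
      = α / (u x *
          Real.sqrt (1 + (fderiv ℝ u x (1, 0)) ^ 2 + (fderiv ℝ u x (0, 1)) ^ 2))) :
    ∫ x in Ω, Real.sqrt (1 + (fderiv ℝ u x (1, 0)) ^ 2 + (fderiv ℝ u x (0, 1)) ^ 2)
      ≥ -(2 * Real.pi / α) * (h ^ 2 - c ^ 2) := by
  change ∫ x in Ω, areaElement u x ≥ _
  have huc := hu.continuousOn
  have huΩ : ContDiffOn ℝ 2 u Ω := hu.mono subset_closure
  have hW := integrableOn_areaElement hΩopen hΩbdd hu
  have hWpos : ∀ x, 0 ≤ areaElement u x := fun x ↦ zero_le_one.trans (one_le_areaElement u x)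
  obtain ⟨x₀, hx₀, rfl⟩ := hh.1
  rcases (hge x₀ hx₀).eq_or_lt with heq | hlt
  · rw [← heq, sub_self, mul_zero]
    exact integral_nonneg hWpos
  have hx₀Ω : x₀ ∈ Ω := by
    by_contra hx
    exact hlt.ne' (hbd x₀ ⟨hx₀, by rwa [hΩopen.interior_eq]⟩)
  have hfin : ∀ s, volume {x | x ∈ Ω ∧ s < u x} ≠ ⊤ := fun s ↦
    (hΩbdd.subset fun x (hx : x ∈ {x | x ∈ Ω ∧ s < u x}) ↦ hx.1).measure_lt_top.ne
  have bound : ∀ a b, c < a → a < b → b < u x₀ →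
      4 * Real.pi / -α * ((b ^ 2 - a ^ 2) / 2) ≤ ∫ x in Ω, areaElement u x := by
    intro a b hca hab hb
    have hα' : 0 < -α := by linarith
    have h1 := sq_sub_sq_le_of_level_inequality (κ := 4 * Real.pi / -α) (by positivity)
      (hc.trans hca) hab (A := fun s ↦ ∫ x in {x | x ∈ Ω ∧ s < u x}, areaElement u x)
      (μ := fun s ↦ volume.real {x | x ∈ Ω ∧ s < u x})
      (fun s hs ↦ ENNReal.toReal_pos ((isOpen_superlevel hΩopen huΩ.continuousOn s).measure_pos
        volume ⟨x₀, hx₀Ω, hs.2.trans_lt hb⟩).ne' (hfin s))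
      (fun s _ s' _ hss' ↦ measureReal_mono (fun x hx ↦ ⟨hx.1, hss'.trans_lt hx.2⟩) (hfin s))
      (fun s hs s' _ hss' ↦ by
        have := level_set_inequality hα hc hΩopen hΩbdd huc huΩ hbd hW hpde
          (hca.trans_le hs.1) hss'
        rw [div_mul_eq_mul_div, div_mul_eq_mul_div, div_mul_eq_mul_div, div_le_iff₀ hα']
        linarith)
    have h2 : 0 ≤ ∫ x in {x | x ∈ Ω ∧ b < u x}, areaElement u x := integral_nonneg hWpos
    have h3 : ∫ x in {x | x ∈ Ω ∧ a < u x}, areaElement u x ≤ ∫ x in Ω, areaElement u x :=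
      setIntegral_mono_set hW (.of_forall hWpos) (.of_forall fun x hx ↦ hx.1)
    linarith
  have hlim : Filter.Tendsto
      (fun δ : ℝ ↦ 4 * Real.pi / -α * (((u x₀ - δ) ^ 2 - (c + δ) ^ 2) / 2))
      (nhdsWithin 0 (Set.Ioi 0)) (nhds (-(2 * Real.pi / α) * (u x₀ ^ 2 - c ^ 2))) := by
    have h1 : Continuous fun δ : ℝ ↦
        4 * Real.pi / -α * (((u x₀ - δ) ^ 2 - (c + δ) ^ 2) / 2) := by fun_prop
    have h2 := (h1.tendsto 0).mono_left (nhdsWithin_le_nhds (s := Set.Ioi 0))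
    convert h2 using 2
    rw [sub_zero, add_zero, div_neg]
    ring
  refine le_of_tendsto hlim ?_
  filter_upwards [Ioo_mem_nhdsGT (show 0 < (u x₀ - c) / 2 by linarith)] with δ hδ
  exact bound _ _ (by linarith [hδ.1]) (by linarith [hδ.2]) (by linarith [hδ.1])
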